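/- arXiv:math/0609362 — 3 statements merged into one kernel-verified Lean document; each statement's English description precedes it below -/
import Mathlib

section
/- Let f : X → X be a continuous map of a compact metric space and let a_n : X → ℝ (n ≥ 0) be continuous functions satisfying the subadditivity a_{n+k}(x) ≤ a_n(f^k(x)) + a_k(x) for all x, n, k. Suppose there exist continuous functions b_n : X → ℝ with a_n(x) ≤ a_n(f^k(x)) + a_k(x) + b_k(f^n(x)) for all x, n, k. If inf_n (1/n)∫_X a_n dμ < 0 for every ergodic f-invariant Borel probability measure μ, then there exists N ≥ 1 such that a_N(x) < 0 for every x ∈ X. -/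
open MeasureTheory

open Filter Topology Set
open scoped ENNReal BoundedContinuousFunction

section Empirical

variable {X : Type*} [MeasurableSpace X]

/-- The uniform probability measure on the first `n` points of the orbit of `x` under `f`. -/
noncomputable def orbitMeasure (f : X → X) (n : ℕ) (x : X) : Measure X :=
  (n : ℝ≥0∞)⁻¹ • ∑ i ∈ Finset.range n, Measure.dirac (f^[i] x)

lemma isProbabilityMeasure_orbitMeasure (f : X → X) {n : ℕ} (hn : n ≠ 0) (x : X) :
    IsProbabilityMeasure (orbitMeasure f n x) := by
  refine ⟨?_⟩
  simp [orbitMeasure, ENNReal.inv_mul_cancel (Nat.cast_ne_zero.2 hn) (ENNReal.natCast_ne_top n)]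

variable [TopologicalSpace X] [OpensMeasurableSpace X]

lemma integral_orbitMeasure (f : X → X) (n : ℕ) (x : X) (g : X →ᵇ ℝ) :
    ∫ y, g y ∂orbitMeasure f n x = birkhoffAverage ℝ f g n x := by
  rw [orbitMeasure, integral_smul_measure,
    integral_finsetSum_measure fun i _ => g.integrable (Measure.dirac (f^[i] x))]
  simp [birkhoffAverage, birkhoffSum, integral_dirac' _ _ g.continuous.stronglyMeasurable]

end Empirical

/-- Along a suitable ultrafilter, orbit averages converge to integrals against an invariant
probability measure. -/
lemma exists_measurePreserving_tendsto_birkhoffAverage {X : Type*} [MetricSpace X] [CompactSpace X]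
    [MeasurableSpace X] [BorelSpace X] {f : X → X} (hf : Continuous f) (x : ℕ → X) :
    ∃ (μ : ProbabilityMeasure X) (U : Ultrafilter ℕ), (U : Filter ℕ) ≤ atTop ∧
      MeasurePreserving f (μ : Measure X) μ ∧ ∀ g : X →ᵇ ℝ,
        Tendsto (fun n => birkhoffAverage ℝ f g (n + 1) (x n)) U
          (𝓝 (∫ y, g y ∂(μ : Measure X))) := by
  let ν : ℕ → ProbabilityMeasure X := fun n =>
    ⟨orbitMeasure f (n + 1) (x n), isProbabilityMeasure_orbitMeasure f n.succ_ne_zero _⟩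
  obtain ⟨μ, -, hμ⟩ := isCompact_univ.ultrafilter_le_nhds ((hyperfilter ℕ).map ν) (by simp)
  have hU : ((hyperfilter ℕ : Ultrafilter ℕ) : Filter ℕ) ≤ atTop :=
    Nat.hyperfilter_le_atTop
  have hlim : ∀ g : X →ᵇ ℝ, Tendsto (fun n => birkhoffAverage ℝ f g (n + 1) (x n))
      (hyperfilter ℕ : Ultrafilter ℕ) (𝓝 (∫ y, g y ∂(μ : Measure X))) := by
    intro g
    have h := ProbabilityMeasure.tendsto_iff_forall_integral_tendsto.1 (show Tendsto ν _ _ from hμ) g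
    simpa only [ν, ProbabilityMeasure.coe_mk, integral_orbitMeasure] using h
  refine ⟨μ, hyperfilter ℕ, hU, ⟨hf.measurable, ?_⟩, hlim⟩
  have : IsProbabilityMeasure ((μ : Measure X).map f) :=
    Measure.isProbabilityMeasure_map hf.aemeasurable
  refine ext_of_forall_integral_eq_of_IsFiniteMeasure fun g => ?_
  rw [integral_map hf.aemeasurable g.continuous.aestronglyMeasurable]
  have h1 := hlim (g.compContinuous ⟨f, hf⟩)
  have h0 : Tendsto (fun n => birkhoffAverage ℝ f (g.compContinuous ⟨f, hf⟩) (n + 1) (x n) -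
      birkhoffAverage ℝ f g (n + 1) (x n)) (hyperfilter ℕ : Ultrafilter ℕ) (𝓝 0) := by
    refine Tendsto.mono_left ?_ hU
    have hz : Tendsto (fun n : ℕ => 2 * ‖g‖ / ((n + 1 : ℕ) : ℝ)) atTop (𝓝 0) :=
      (tendsto_add_atTop_iff_nat 1).2 (tendsto_const_div_atTop_nhds_zero_nat (2 * ‖g‖))
    refine squeeze_zero_norm (fun n => ?_) hz
    have he : birkhoffAverage ℝ f (g.compContinuous ⟨f, hf⟩) (n + 1) (x n) =
        birkhoffAverage ℝ f g (n + 1) (f (x n)) := by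
      simp [birkhoffAverage, birkhoffSum, ← Function.iterate_succ_apply,
        Function.iterate_succ_apply']
    rw [he, ← dist_eq_norm, dist_birkhoffAverage_apply_birkhoffAverage]
    gcongr
    exact g.dist_le_two_norm _ _
  have := tendsto_nhds_unique h0 (h1.sub (hlim g))
  simp only [BoundedContinuousFunction.compContinuous_apply, ContinuousMap.coe_mk] at this
  linarith

/-- An orbit sum of `a n` is bounded below in terms of the value of a subadditive cocycle at a
later time. -/
lemma le_birkhoffSum_of_subadditive {X : Type*} {f : X → X} {a : ℕ → X → ℝ}
    (hsub : ∀ x : X, ∀ n k : ℕ, a (n + k) x ≤ a n (f^[k] x) + a k x)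
    {n : ℕ} {C : ℝ} (hC : ∀ i ≤ n, ∀ x, |a i x| ≤ C) (m : ℕ) (x : X) :
    n * a (m + n) x - 3 * n * C ≤ birkhoffSum f (a n) (m + n) x := by
  have hM : ∑ j ∈ Finset.range n, (a (m + j) x - a j x) ≤ birkhoffSum f (a n) m x := by
    induction m with
    | zero => simp
    | succ m ih =>
      rw [birkhoffSum_succ]
      have h1 : ∑ j ∈ Finset.range n, (a (m + 1 + j) x - a j x) =
          ∑ j ∈ Finset.range n, (a (m + j) x - a j x) + (a (m + n) x - a m x) := by
        rw [← sub_eq_iff_eq_add', ← Finset.sum_sub_distrib]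
        have h2 := Finset.sum_range_sub (fun j => a (m + j) x) n
        simp only [add_zero] at h2
        rw [← h2]
        refine Finset.sum_congr rfl fun j _ => ?_
        rw [show m + 1 + j = m + (j + 1) by ring]
        ring
      have h3 := hsub x n m
      rw [add_comm n m] at h3
      linarith
  have hadd : birkhoffSum f (a n) (m + n) x =
      birkhoffSum f (a n) m x + ∑ j ∈ Finset.range n, a n (f^[m + j] x) := by
    simp [birkhoffSum, Finset.sum_range_add]
  rw [hadd]
  have hb : ∑ j ∈ Finset.range n, (a (m + n) x - 3 * C) ≤
      ∑ j ∈ Finset.range n, (a (m + j) x - a j x + a n (f^[m + j] x)) := by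
    refine Finset.sum_le_sum fun j hj => ?_
    have hj' : j ≤ n := (Finset.mem_range.1 hj).le
    have h1 := hsub x (n - j) (m + j)
    rw [show n - j + (m + j) = m + n by omega] at h1
    have h2 := abs_le.1 (hC (n - j) (Nat.sub_le _ _) (f^[m + j] x))
    have h3 := abs_le.1 (hC j hj' x)
    have h4 := abs_le.1 (hC n le_rfl (f^[m + j] x))
    linarith [h2.1, h2.2, h3.1, h3.2, h4.1, h4.2]
  rw [Finset.sum_add_distrib] at hb
  simp only [Finset.sum_const, Finset.card_range, nsmul_eq_mul] at hb
  linarith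

/-- If a subadditive cocycle has growth at least `β` at every time somewhere, then it has average
growth at least `β` for some invariant probability measure. -/
lemma exists_measurePreserving_le_integral {X : Type*} [MetricSpace X] [CompactSpace X]
    [MeasurableSpace X] [BorelSpace X] {f : X → X} (hf : Continuous f)
    {a : ℕ → X → ℝ} (ha : ∀ n, Continuous (a n))
    (hsub : ∀ x : X, ∀ n k : ℕ, a (n + k) x ≤ a n (f^[k] x) + a k x)
    {β : ℝ} (hβ : ∀ n, 0 < n → ∃ x, n * β ≤ a n x) :
    ∃ μ : ProbabilityMeasure X, MeasurePreserving f (μ : Measure X) μ ∧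
      ∀ n, 0 < n → n * β ≤ ∫ x, a n x ∂(μ : Measure X) := by
  choose x hx using fun n : ℕ => hβ (n + 1) n.succ_pos
  obtain ⟨μ, U, hU, hinv, hlim⟩ := exists_measurePreserving_tendsto_birkhoffAverage hf x
  refine ⟨μ, hinv, fun n hn => ?_⟩
  have hbd : ∀ i, ∃ C, ∀ y, |a i y| ≤ C := fun i => by
    obtain ⟨C, hC⟩ := isCompact_univ.exists_bound_of_continuousOn (ha i).continuousOn
    exact ⟨C, fun y => hC y (mem_univ y)⟩
  choose C hC using hbd
  have hC' : ∀ i ≤ n, ∀ y, |a i y| ≤ ∑ j ∈ Finset.range (n + 1), C j := fun i hi y =>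
    (hC i y).trans (Finset.single_le_sum (f := C)
      (fun j _ => (abs_nonneg _).trans (hC j y)) (Finset.mem_range.2 (Nat.lt_succ_of_le hi)))
  set D := ∑ j ∈ Finset.range (n + 1), C j
  have hz : Tendsto (fun k : ℕ => n * β - 3 * n * D / ((k + 1 : ℕ) : ℝ)) U (𝓝 (n * β - 0)) :=
    (tendsto_const_nhds.sub ((tendsto_add_atTop_iff_nat 1).2
      (tendsto_const_div_atTop_nhds_zero_nat (3 * n * D)))).mono_left hU
  rw [sub_zero] at hz
  refine le_of_tendsto_of_tendsto hz (hlim (BoundedContinuousFunction.mkOfCompact ⟨a n, ha n⟩))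
    (hU ?_)
  filter_upwards [eventually_ge_atTop n] with k hk
  obtain ⟨m, hm⟩ : ∃ m, k + 1 = m + n := ⟨k + 1 - n, by omega⟩
  have h1 := le_birkhoffSum_of_subadditive hsub hC' m (x k)
  rw [← hm] at h1
  have h2 := mul_le_mul_of_nonneg_left (hx k) (Nat.cast_nonneg (α := ℝ) n)
  have hk0 : (0 : ℝ) < ((k + 1 : ℕ) : ℝ) := by positivity
  change _ ≤ (((k + 1 : ℕ) : ℝ))⁻¹ • birkhoffSum f (a n) (k + 1) (x k)
  rw [smul_eq_mul, inv_mul_eq_div, le_div_iff₀ hk0, sub_mul, div_mul_cancel₀ _ hk0.ne']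
  linarith

section Invariant

variable {X : Type*} [MetricSpace X] [CompactSpace X] [MeasurableSpace X] [BorelSpace X]
  {f : X → X} {a : ℕ → X → ℝ} {μ : Measure X} [IsProbabilityMeasure μ]

lemma Continuous.integrable_of_compactSpace {g : X → ℝ} (hg : Continuous g) : Integrable g μ :=
  hg.integrable_of_hasCompactSupport (HasCompactSupport.of_compactSpace g)

lemma integral_mul_le_of_subadditive (ha : ∀ n, Continuous (a n))
    (hsub : ∀ x : X, ∀ n k : ℕ, a (n + k) x ≤ a n (f^[k] x) + a k x)
    (hμ : MeasurePreserving f μ μ) (n : ℕ) {k : ℕ} (hk : 0 < k) :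
    ∫ x, a (k * n) x ∂μ ≤ k * ∫ x, a n x ∂μ := by
  induction k, hk using Nat.le_induction with
  | base => simp
  | succ k hk ih =>
    have hcomp := (hμ.iterate n).integrable_comp_of_integrable
      (ha (k * n)).integrable_of_compactSpace
    have h1 : ∫ x, a (k * n) (f^[n] x) ∂μ = ∫ x, a (k * n) x ∂μ := by
      have h := integral_map (μ := μ) (hμ.iterate n).measurable.aemeasurable
        (ha (k * n)).aestronglyMeasurable
      rw [(hμ.iterate n).map_eq] at h
      exact h.symm
    have h2 : ∫ x, a ((k + 1) * n) x ∂μ ≤ ∫ x, (a (k * n) (f^[n] x) + a n x) ∂μ := by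
      refine integral_mono (ha _).integrable_of_compactSpace
        (hcomp.add (ha n).integrable_of_compactSpace) fun x => ?_
      simpa [add_mul] using hsub x (k * n) n
    have h3 : ∫ x, (a (k * n) (f^[n] x) + a n x) ∂μ =
        ∫ x, a (k * n) (f^[n] x) ∂μ + ∫ x, a n x ∂μ :=
      integral_add hcomp (ha n).integrable_of_compactSpace
    push_cast
    linarith

/-- The invariant measures whose average growth attains the maximal growth rate `β` form an
extreme set. -/
lemma le_integral_of_convex_combination (ha : ∀ n, Continuous (a n))
    (hsub : ∀ x : X, ∀ n k : ℕ, a (n + k) x ≤ a n (f^[k] x) + a k x) {β : ℝ}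
    (hβ : ∀ ε > 0, ∃ p, 0 < p ∧ ∀ x, a p x ≤ p * (β + ε))
    {ν : Measure X} [IsProbabilityMeasure ν]
    (hμ : MeasurePreserving f μ μ) (hν : MeasurePreserving f ν ν) {s t : ℝ} (hs : 0 < s)
    (ht : 0 < t) (hst : s + t = 1)
    (h : ∀ n, 0 < n → n * β ≤ s * ∫ x, a n x ∂μ + t * ∫ x, a n x ∂ν) {n : ℕ} (hn : 0 < n) :
    n * β ≤ ∫ x, a n x ∂μ := by
  by_contra! hlt
  have hn' : (0 : ℝ) < n := Nat.cast_pos.2 hn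
  set I := ∫ x, a n x ∂μ
  obtain ⟨p, hp, hap⟩ := hβ (s * (n * β - I) / (2 * n * t))
    (div_pos (mul_pos hs (sub_pos.2 hlt)) (by positivity))
  set ε := s * (n * β - I) / (2 * n * t) with hε
  have hp' : (0 : ℝ) < p := Nat.cast_pos.2 hp
  have h1 : ∫ x, a (p * n) x ∂μ ≤ p * I := integral_mul_le_of_subadditive ha hsub hμ n hp
  have h2 : ∫ x, a (p * n) x ∂ν ≤ n * (p * (β + ε)) := by
    rw [mul_comm p n]
    refine (integral_mul_le_of_subadditive ha hsub hν p hn).trans ?_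
    gcongr
    simpa using integral_mono (μ := ν) (ha p).integrable_of_compactSpace
      (integrable_const (p * (β + ε))) hap
  have h3 := h (p * n) (Nat.mul_pos hp hn)
  push_cast at h3
  have h4 : p * n * β ≤ s * (p * I) + t * (n * (p * (β + ε))) := h3.trans (by gcongr)
  have h5 : t * n * ε = s * (n * β - I) / 2 := by
    rw [hε]; field_simp
  have h6 : s * (p * I) + t * (n * (p * (β + ε))) = p * n * β - p * (s * (n * β - I) / 2) := by
    rw [← eq_sub_iff_add_eq'] at hst
    have : t * (n * (p * (β + ε))) = p * (n * β * t) + p * (t * n * ε) := by ring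
    rw [this, h5, hst]
    ring
  have h7 : 0 < p * (s * (n * β - I) / 2) := by
    have := sub_pos.2 hlt
    positivity
  linarith

end Invariant

/-- If `β` is the maximal growth rate of a subadditive cocycle, some ergodic probability measure
has average growth at least `β`. -/
lemma exists_ergodic_le_integral {X : Type*} [MetricSpace X] [CompactSpace X]
    [MeasurableSpace X] [BorelSpace X] {f : X → X} (hf : Continuous f)
    {a : ℕ → X → ℝ} (ha : ∀ n, Continuous (a n))
    (hsub : ∀ x : X, ∀ n k : ℕ, a (n + k) x ≤ a n (f^[k] x) + a k x)
    {β : ℝ} (hlow : ∀ n, 0 < n → ∃ x, n * β ≤ a n x)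
    (hupp : ∀ ε > 0, ∃ p, 0 < p ∧ ∀ x, a p x ≤ p * (β + ε)) :
    ∃ μ : Measure X, IsProbabilityMeasure μ ∧ Ergodic f μ ∧
      ∀ n, 0 < n → n * β ≤ ∫ x, a n x ∂μ := by
  let S : Set (ProbabilityMeasure X) := {μ | MeasurePreserving f (μ : Measure X) μ ∧
    ∀ n, 0 < n → n * β ≤ ∫ x, a n x ∂(μ : Measure X)}
  let Φ : ProbabilityMeasure X → (X →ᵇ ℝ) → ℝ := fun μ g => ∫ x, g x ∂(μ : Measure X)
  have hΦ : Continuous Φ := continuous_pi fun g => continuous_iff_continuousAt.2 fun μ =>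
    ProbabilityMeasure.tendsto_iff_forall_integral_tendsto.1 tendsto_id g
  have hS : IsClosed S := by
    have h1 : IsClosed {μ : ProbabilityMeasure X | MeasurePreserving f (μ : Measure X) μ} := by
      have : {μ : ProbabilityMeasure X | MeasurePreserving f (μ : Measure X) μ} =
          {μ | μ.map hf.aemeasurable = μ} := by
        ext μ
        refine ⟨fun h => Subtype.ext h.map_eq, fun h => ⟨hf.measurable, congrArg Subtype.val h⟩⟩
      rw [this]
      exact isClosed_eq (ProbabilityMeasure.continuous_map hf) continuous_id
    have h2 : IsClosed {μ : ProbabilityMeasure X |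
        ∀ n, 0 < n → n * β ≤ ∫ x, a n x ∂(μ : Measure X)} := by
      simp only [ofPred_forall]
      exact isClosed_iInter fun n => isClosed_iInter fun _ => isClosed_le continuous_const
        ((continuous_apply (BoundedContinuousFunction.mkOfCompact ⟨a n, ha n⟩)).comp hΦ)
    exact h1.inter h2
  obtain ⟨e, ⟨μ, hμS, rfl⟩, hext⟩ := (hS.isCompact.image hΦ).extremePoints_nonempty
    (Set.Nonempty.image Φ (exists_measurePreserving_le_integral hf ha hsub hlow))
  refine ⟨μ, inferInstance, Ergodic.of_mem_extremePoints ?_, hμS.2⟩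
  refine mem_extremePoints_iff_left.2 ⟨⟨hμS.1, inferInstance⟩, ?_⟩
  rintro ν₁ ⟨hν₁, hp₁⟩ ν₂ ⟨hν₂, hp₂⟩ ⟨s, t, hs, ht, hst, hμ⟩
  have hs1 : s ≠ ∞ := ((le_self_add.trans hst.le).trans_lt ENNReal.one_lt_top).ne
  have ht1 : t ≠ ∞ := ((le_add_self.trans hst.le).trans_lt ENNReal.one_lt_top).ne
  have hs' := ENNReal.toReal_pos hs.ne' hs1
  have ht' := ENNReal.toReal_pos ht.ne' ht1
  have hst' : s.toReal + t.toReal = 1 := by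
    rw [← ENNReal.toReal_add hs1 ht1, hst, ENNReal.toReal_one]
  have hint : ∀ g : X → ℝ, Continuous g →
      ∫ x, g x ∂(μ : Measure X) = s.toReal * ∫ x, g x ∂ν₁ + t.toReal * ∫ x, g x ∂ν₂ := by
    intro g hg
    rw [← hμ, integral_add_measure (hg.integrable_of_compactSpace.smul_measure hs1)
      (hg.integrable_of_compactSpace.smul_measure ht1), integral_smul_measure,
      integral_smul_measure, smul_eq_mul, smul_eq_mul]
  have hge : ∀ n, 0 < n →
      n * β ≤ s.toReal * ∫ x, a n x ∂ν₁ + t.toReal * ∫ x, a n x ∂ν₂ := fun n hn =>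
    (hμS.2 n hn).trans_eq (hint _ (ha n))
  have hS₁ : (⟨ν₁, hp₁⟩ : ProbabilityMeasure X) ∈ S := ⟨hν₁, fun n hn =>
    le_integral_of_convex_combination ha hsub hupp hν₁ hν₂ hs' ht' hst' hge hn⟩
  have hS₂ : (⟨ν₂, hp₂⟩ : ProbabilityMeasure X) ∈ S := ⟨hν₂, fun n hn =>
    le_integral_of_convex_combination ha hsub hupp hν₂ hν₁ ht' hs' ((add_comm _ _).trans hst')
      (fun n hn => (hge n hn).trans_eq (add_comm _ _)) hn⟩
  have hΦeq := hext (mem_image_of_mem Φ hS₁) (mem_image_of_mem Φ hS₂)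
    ⟨s.toReal, t.toReal, hs', ht', hst', funext fun g => (hint g g.continuous).symm⟩
  exact ext_of_forall_integral_eq_of_IsFiniteMeasure fun g => congrFun hΦeq g

/-- Subadditive ergodic criterion: if for every ergodic invariant probability measure the
infimum of `(1/n)∫ aₙ` is negative, then some `a_N` is everywhere negative. -/
theorem neg_of_neg_integral_ergodic {X : Type*} [MetricSpace X] [CompactSpace X]
    [MeasurableSpace X] [BorelSpace X]
    (f : X → X) (hf : Continuous f)
    (a b : ℕ → X → ℝ) (ha : ∀ n, Continuous (a n)) (hb : ∀ n, Continuous (b n))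
    (hsub : ∀ x : X, ∀ n k : ℕ, a (n + k) x ≤ a n (f^[k] x) + a k x)
    (hsup : ∀ x : X, ∀ n k : ℕ, a n x ≤ a n (f^[k] x) + a k x + b k (f^[n] x))
    (hμ : ∀ μ : Measure X, IsProbabilityMeasure μ → Ergodic f μ →
      ∃ n : ℕ, 0 < n ∧ (1 / (n : ℝ)) * ∫ x, a n x ∂μ < 0) :
    ∃ N : ℕ, 0 < N ∧ ∀ x : X, a N x < 0 := by
  by_contra! hcon
  let R : Set ℝ := {c | ∃ n : ℕ, 0 < n ∧ ∀ x, a n x ≤ n * c}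
  have hnonneg : ∀ c ∈ R, 0 ≤ c := by
    rintro c ⟨n, hn, hc⟩
    obtain ⟨x, hx⟩ := hcon n hn
    exact nonneg_of_mul_nonneg_right (hx.trans (hc x)) (Nat.cast_pos.2 hn)
  have hmax : ∀ n : ℕ, 0 < n → ∃ x, a n x / n ∈ R := by
    intro n hn
    obtain ⟨x₀, -⟩ := hcon n hn
    obtain ⟨x, -, hx⟩ := isCompact_univ.exists_isMaxOn ⟨x₀, mem_univ x₀⟩ (ha n).continuousOn
    refine ⟨x, n, hn, fun y => ?_⟩
    rw [mul_div_cancel₀ _ (Nat.cast_ne_zero.2 hn.ne')]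
    exact hx (mem_univ y)
  have hR : R.Nonempty := let ⟨x, hx⟩ := hmax 1 one_pos; ⟨_, hx⟩
  obtain ⟨μ, hp, herg, hge⟩ := exists_ergodic_le_integral (β := sInf R) hf ha hsub
    (fun n hn => by
      obtain ⟨x, hx⟩ := hmax n hn
      refine ⟨x, ?_⟩
      rw [mul_comm, ← le_div_iff₀ (Nat.cast_pos.2 hn)]
      exact csInf_le ⟨0, hnonneg⟩ hx)
    (fun ε hε => by
      obtain ⟨c, ⟨p, hp, hc⟩, hlt⟩ := exists_lt_of_csInf_lt hR (lt_add_of_pos_right (sInf R) hε)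
      exact ⟨p, hp, fun x => (hc x).trans (by gcongr)⟩)
  obtain ⟨n, hn, hlt⟩ := hμ μ hp herg
  have h0 : 0 ≤ ∫ x, a n x ∂μ :=
    (mul_nonneg n.cast_nonneg (le_csInf hR hnonneg)).trans (hge n hn)
  exact hlt.not_ge (by positivity)
end

section
/- Let f : X → X be a continuous map of a compact metric space, and let φ : X → ℝ be continuous. If ∫_X φ dμ < C for every ergodic f-invariant Borel probability measure μ, then there exists N₀ such that for every x ∈ X and every n ≥ N₀, (1/n)·Σ_{k=0}^{n−1} φ(f^k(x)) < C. -/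
open MeasureTheory

section InvariantMeasures

open Filter Topology Set
open scoped ENNReal

/-- The empirical measure of the first `n` points of the orbit of `x` under `f`. -/
noncomputable def empiricalMeasure {X : Type*} [MeasurableSpace X] (f : X → X) (n : ℕ) (x : X) :
    Measure X :=
  (n : ℝ≥0∞)⁻¹ • ∑ k ∈ Finset.range n, Measure.dirac (f^[k] x)

theorem isProbabilityMeasure_empiricalMeasure {X : Type*} [MeasurableSpace X] (f : X → X) {n : ℕ}
    (hn : n ≠ 0) (x : X) : IsProbabilityMeasure (empiricalMeasure f n x) := by
  constructor
  simp [empiricalMeasure, ENNReal.inv_mul_cancel, hn]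

theorem eq_of_convex_combination_eq_of_le {a b x y M : ℝ} (ha : 0 < a) (hb : 0 ≤ b)
    (hab : a + b = 1) (hx : x ≤ M) (hy : y ≤ M) (h : a * x + b * y = M) : x = M := by
  obtain rfl : b = 1 - a := by linarith
  exact hx.antisymm (le_of_mul_le_mul_left (by nlinarith) ha)

variable {X : Type*} [MetricSpace X] [MeasurableSpace X] [BorelSpace X]

theorem MeasureTheory.Measure.eq_of_forall_integral_continuousMap_eq {μ ν : Measure X}
    [IsFiniteMeasure μ] [IsFiniteMeasure ν] (h : ∀ g : C(X, ℝ), ∫ x, g x ∂μ = ∫ x, g x ∂ν) :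
    μ = ν :=
  ext_of_forall_integral_eq_of_IsFiniteMeasure fun g ↦ h g.toContinuousMap

theorem measurePreserving_iff_forall_integral_comp_eq {f : C(X, X)} {μ : Measure X}
    [IsFiniteMeasure μ] :
    MeasurePreserving f μ μ ↔ ∀ g : C(X, ℝ), ∫ x, g.comp f x ∂μ = ∫ x, g x ∂μ := by
  have hmap (g : C(X, ℝ)) : ∫ x, g.comp f x ∂μ = ∫ x, g x ∂(μ.map f) :=
    (integral_map f.measurable.aemeasurable g.continuous.aestronglyMeasurable).symm
  refine ⟨fun h g ↦ by rw [hmap, h.map_eq], fun h ↦ ⟨f.measurable, ?_⟩⟩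
  exact Measure.eq_of_forall_integral_continuousMap_eq fun g ↦ by rw [← hmap, h]

variable [CompactSpace X]

theorem ContinuousMap.integrable_of_compactSpace (μ : Measure X) [IsFiniteMeasure μ]
    (g : C(X, ℝ)) : Integrable g μ :=
  g.continuous.integrable_of_hasCompactSupport (HasCompactSupport.of_compactSpace g)

theorem integral_empiricalMeasure (f : X → X) (g : C(X, ℝ)) (n : ℕ) (x : X) :
    ∫ y, g y ∂empiricalMeasure f n x = birkhoffAverage ℝ f g n x := by
  rw [empiricalMeasure, integral_smul_measure,
    integral_finsetSum_measure fun _ _ ↦ g.integrable_of_compactSpace _]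
  simp [birkhoffAverage, birkhoffSum]

theorem isClosed_setOfPred_measurePreserving (f : C(X, X)) :
    IsClosed {μ : ProbabilityMeasure X | MeasurePreserving f (μ : Measure X) μ} := by
  simp only [measurePreserving_iff_forall_integral_comp_eq, ofPred_forall]
  exact isClosed_iInter fun g ↦ isClosed_eq
    (ProbabilityMeasure.continuous_integral_continuousMap _)
    (ProbabilityMeasure.continuous_integral_continuousMap _)

/-- If arbitrarily long Birkhoff averages of `φ` are at least `C`, then some invariant probability
measure gives `φ` an integral at least `C`. -/
theorem exists_measurePreserving_le_integral_s6 (f : C(X, X)) (φ : C(X, ℝ)) {C : ℝ}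
    (h : ∀ N, ∃ n ≥ N, n ≠ 0 ∧ ∃ x, C ≤ birkhoffAverage ℝ f φ n x) :
    ∃ μ : ProbabilityMeasure X, MeasurePreserving f (μ : Measure X) μ ∧ C ≤ ∫ x, φ x ∂μ := by
  choose n hn hn0 x hx using h
  let ν (N : ℕ) : ProbabilityMeasure X :=
    ⟨empiricalMeasure f (n N) (x N), isProbabilityMeasure_empiricalMeasure f (hn0 N) (x N)⟩
  have hν (g : C(X, ℝ)) (N : ℕ) :
      ∫ y, g y ∂(ν N : Measure X) = birkhoffAverage ℝ f g (n N) (x N) :=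
    integral_empiricalMeasure f g (n N) (x N)
  let U := (hyperfilter ℕ).map ν
  obtain ⟨μ, -, hμ⟩ := isCompact_univ.ultrafilter_le_nhds U (by simp)
  have hlim (g : C(X, ℝ)) : Tendsto (fun N ↦ birkhoffAverage ℝ f g (n N) (x N)) (hyperfilter ℕ)
      (𝓝 (∫ y, g y ∂(μ : Measure X))) := by
    simp only [← hν]
    exact ((ProbabilityMeasure.continuous_integral_continuousMap g).tendsto μ).comp hμ
  refine ⟨μ, measurePreserving_iff_forall_integral_comp_eq.2 fun g ↦ ?_,
    ge_of_tendsto (hlim φ) (.of_forall hx)⟩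
  have hn_top : Tendsto (fun N ↦ (n N : ℝ)) atTop atTop :=
    tendsto_natCast_atTop_atTop.comp (tendsto_atTop_mono hn tendsto_id)
  have hdiff : Tendsto (fun N ↦ birkhoffAverage ℝ f (g.comp f) (n N) (x N)
      - birkhoffAverage ℝ f g (n N) (x N)) atTop (𝓝 0) := by
    refine squeeze_zero_norm (fun N ↦ ?_) (hn_top.const_div_atTop (‖g‖ + ‖g‖))
    have hshift : birkhoffAverage ℝ f (g.comp f) (n N) (x N)
        = birkhoffAverage ℝ f g (n N) (f (x N)) := by
      simp [birkhoffAverage, birkhoffSum, ← Function.iterate_succ_apply,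
        Function.iterate_succ_apply']
    rw [hshift, birkhoffAverage_apply_sub_birkhoffAverage, norm_smul, norm_inv, Real.norm_natCast,
      inv_mul_eq_div]
    gcongr
    exact norm_sub_le_of_le (g.norm_coe_le_norm _) (g.norm_coe_le_norm _)
  exact sub_eq_zero.1 (tendsto_nhds_unique ((hlim _).sub (hlim _))
    (hdiff.mono_left Nat.hyperfilter_le_atTop))

/-- Among the invariant probability measures maximizing the integral of `φ` there is an ergodic
one. -/
theorem exists_ergodic_integral_le (f : C(X, X)) (φ : C(X, ℝ)) {ν : ProbabilityMeasure X}
    (hν : MeasurePreserving f (ν : Measure X) ν) :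
    ∃ μ : ProbabilityMeasure X, Ergodic f (μ : Measure X) ∧ ∫ x, φ x ∂ν ≤ ∫ x, φ x ∂μ := by
  let K := {μ : ProbabilityMeasure X | MeasurePreserving f (μ : Measure X) μ}
  have hK : IsCompact K := (isClosed_setOfPred_measurePreserving f).isCompact
  have hcont (g : C(X, ℝ)) := ProbabilityMeasure.continuous_integral_continuousMap g
  obtain ⟨m, hm, hmax⟩ := hK.exists_isMaxOn ⟨ν, hν⟩ (hcont φ).continuousOn
  let M := K ∩ {μ | ∫ x, φ x ∂(μ : Measure X) = ∫ x, φ x ∂(m : Measure X)}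
  let T (μ : ProbabilityMeasure X) (g : C(X, ℝ)) : ℝ := ∫ x, g x ∂(μ : Measure X)
  have hTM : IsCompact (T '' M) :=
    (hK.inter_right (isClosed_eq (hcont φ) continuous_const)).image (continuous_pi hcont)
  obtain ⟨_, ⟨μ, ⟨hμ, hμm⟩, rfl⟩, hext⟩ := hTM.extremePoints_nonempty ⟨T m, m, ⟨hm, rfl⟩, rfl⟩
  refine ⟨μ, .of_mem_extremePoints (mem_extremePoints_iff_left.2
    ⟨⟨hμ, inferInstance⟩, ?_⟩), (hmax hν).trans_eq hμm.symm⟩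
  rintro ν₁ ⟨hν₁, hp₁⟩ ν₂ ⟨hν₂, hp₂⟩ ⟨a, b, ha, hb, hab, hμab⟩
  have ha_top : a ≠ ∞ := by rintro rfl; simp at hab
  have hb_top : b ≠ ∞ := by rintro rfl; simp at hab
  lift a to NNReal using ha_top
  lift b to NNReal using hb_top
  have ha' : 0 < (a : ℝ) := by exact_mod_cast ha
  have hb' : 0 < (b : ℝ) := by exact_mod_cast hb
  have hab' : (a : ℝ) + b = 1 := by exact_mod_cast hab
  let P₁ : ProbabilityMeasure X := ⟨ν₁, hp₁⟩
  let P₂ : ProbabilityMeasure X := ⟨ν₂, hp₂⟩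
  have hT (g : C(X, ℝ)) : a * T P₁ g + b * T P₂ g = T μ g := by
    change a * ∫ x, g x ∂ν₁ + b * ∫ x, g x ∂ν₂ = ∫ x, g x ∂(μ : Measure X)
    rw [← hμab, integral_add_measure ((g.integrable_of_compactSpace ν₁).smul_measure (by simp))
      ((g.integrable_of_compactSpace ν₂).smul_measure (by simp)), integral_smul_measure,
      integral_smul_measure]
    simp
  have h₁ : T P₁ φ ≤ T m φ := hmax (show P₁ ∈ K from hν₁)
  have h₂ : T P₂ φ ≤ T m φ := hmax (show P₂ ∈ K from hν₂)
  have hφ : a * T P₁ φ + b * T P₂ φ = T m φ := (hT φ).trans hμm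
  have hP₁ : P₁ ∈ M := ⟨hν₁, eq_of_convex_combination_eq_of_le ha' hb'.le hab' h₁ h₂ hφ⟩
  have hP₂ : P₂ ∈ M := ⟨hν₂, eq_of_convex_combination_eq_of_le hb' ha'.le
    ((add_comm _ _).trans hab') h₂ h₁ ((add_comm _ _).trans hφ)⟩
  have heq : T P₁ = T μ := hext (mem_image_of_mem T hP₁) (mem_image_of_mem T hP₂)
    ⟨a, b, ha', hb', hab', funext fun g ↦ by simpa using hT g⟩
  exact Measure.eq_of_forall_integral_continuousMap_eq fun g ↦ congrFun heq g

end InvariantMeasures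

/-- If `∫ φ dμ < C` for every ergodic invariant probability measure `μ` of a continuous map
of a compact metric space, then the Birkhoff averages of `φ` are eventually, uniformly,
below `C`. -/
theorem birkhoff_averages_lt_of_integral_lt {X : Type*} [MetricSpace X] [CompactSpace X]
    [MeasurableSpace X] [BorelSpace X]
    (f : X → X) (hf : Continuous f) (φ : X → ℝ) (hφ : Continuous φ) (C : ℝ)
    (hμ : ∀ μ : Measure X, IsProbabilityMeasure μ → Ergodic f μ → ∫ x, φ x ∂μ < C) :
    ∃ N₀ : ℕ, ∀ x : X, ∀ n : ℕ, N₀ ≤ n → 0 < n →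
      (1 / (n : ℝ)) * ∑ k ∈ Finset.range n, φ (f^[k] x) < C := by
  by_contra! h
  obtain ⟨ν, hν, hCν⟩ := exists_measurePreserving_le_integral_s6 ⟨f, hf⟩ ⟨φ, hφ⟩ (C := C) fun N ↦ by
    obtain ⟨x, n, hn, hn0, hx⟩ := h N
    exact ⟨n, hn, hn0.ne', x, by simpa [birkhoffAverage, birkhoffSum] using hx⟩
  obtain ⟨μ, hμ_erg, hle⟩ := exists_ergodic_integral_le ⟨f, hf⟩ ⟨φ, hφ⟩ hν
  exact (hμ μ inferInstance hμ_erg).not_ge (hCν.trans hle)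
end

section
/- Let A ∈ GL(n, ℤ) and let f_A : 𝕋ⁿ → 𝕋ⁿ be the induced automorphism of the torus 𝕋ⁿ = ℝⁿ/ℤⁿ. Then f_A is ergodic with respect to Haar (Lebesgue) measure if and only if no eigenvalue of A is a root of unity. -/
open MeasureTheory

namespace ToralAutomorphism

open scoped Matrix

section Eigenvalues

variable {d : Type*} [Fintype d] [DecidableEq d]

/-- An integer matrix has an eigenvalue `lam` with `lam ^ m = 1` iff the `m`-th power of the matrix
fixes a nonzero integer row vector. -/
theorem exists_isRoot_charpoly_pow_eq_one_iff (A : Matrix d d ℤ) {m : ℕ} (hm : 1 ≤ m) :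
    (∃ lam : ℂ, (A.map (Int.cast : ℤ → ℂ)).charpoly.IsRoot lam ∧ lam ^ m = 1) ↔
      ∃ k : d → ℤ, k ≠ 0 ∧ k ᵥ* A ^ m = k := by
  set B : Matrix d d ℂ := A.map (Int.cast : ℤ → ℂ)
  have hdet : (B ^ m - 1).det = ((A ^ m - 1).det : ℤ) := by
    have := (Int.castRingHom ℂ).map_det (A ^ m - 1)
    rw [map_sub, map_pow, map_one] at this
    exact this.symm
  have hspec : (∃ lam : ℂ, B.charpoly.IsRoot lam ∧ lam ^ m = 1) ↔ (1 : ℂ) ∈ spectrum ℂ (B ^ m) := by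
    simp_rw [spectrum.map_pow_of_pos B hm, Set.mem_image, Matrix.mem_spectrum_iff_isRoot_charpoly]
  have hfix : (∃ k : d → ℤ, k ≠ 0 ∧ k ᵥ* A ^ m = k) ↔ (A ^ m - 1).det = 0 := by
    simp_rw [← Matrix.exists_vecMul_eq_zero_iff, Matrix.vecMul_sub, Matrix.vecMul_one, sub_eq_zero]
  rw [hspec, hfix, spectrum.mem_iff, map_one, ← IsUnit.neg_iff, neg_sub,
    Matrix.isUnit_iff_isUnit_det, hdet, isUnit_iff_ne_zero, not_not, Int.cast_eq_zero]

end Eigenvalues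

section Fourier

open UnitAddTorus

/-- The measure on `ℝ / ℤ` normalised to have total volume 1, as in the theory of `mFourier`. -/
noncomputable local instance : MeasureSpace UnitAddCircle := ⟨AddCircle.haarAddCircle⟩

local instance : Measure.IsAddHaarMeasure (volume : Measure UnitAddCircle) :=
  inferInstanceAs (Measure.IsAddHaarMeasure AddCircle.haarAddCircle)

local instance : IsProbabilityMeasure (volume : Measure UnitAddCircle) :=
  inferInstanceAs (IsProbabilityMeasure AddCircle.haarAddCircle)

variable {d : Type*} [Fintype d]

theorem mFourier_eq_toCircle (k : d → ℤ) (x : UnitAddTorus d) :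
    mFourier k x = (AddCircle.toCircle (∑ i, k i • x i) : ℂ) := by
  classical
  have h (s : Finset d) : ∏ i ∈ s, fourier (k i) (x i) =
      (AddCircle.toCircle (∑ i ∈ s, k i • x i) : ℂ) := by
    induction s using Finset.induction_on with
    | empty => simp
    | insert a s ha ih =>
      rw [Finset.prod_insert ha, Finset.sum_insert ha, AddCircle.toCircle_add, Circle.coe_mul, ih,
        fourier_apply]
  exact h Finset.univ

variable {A : Matrix d d ℤ} {f : UnitAddTorus d → UnitAddTorus d}

theorem mFourier_comp_apply (hf : ∀ x j, f x j = ∑ i, A j i • x i) (k : d → ℤ)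
    (x : UnitAddTorus d) : mFourier k (f x) = mFourier (k ᵥ* A) x := by
  simp_rw [mFourier_eq_toCircle, hf, Matrix.vecMul, dotProduct, Finset.smul_sum, Finset.sum_smul,
    smul_smul]
  rw [Finset.sum_comm]

theorem integral_mFourier {k : d → ℤ} (hk : k ≠ 0) : ∫ x : UnitAddTorus d, mFourier k x = 0 := by
  have h := (orthonormal_iff_ite.mp (orthonormal_mFourier (d := d))) 0 k
  rw [if_neg hk.symm, ContinuousMap.inner_toLp] at h
  simpa [mFourier_zero] using h

variable [DecidableEq d]

theorem measurePreserving (hA : IsUnit A.det) (hf : ∀ x j, f x j = ∑ i, A j i • x i) :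
    MeasurePreserving f := by
  let F : UnitAddTorus d →+ UnitAddTorus d :=
    { toFun := f
      map_zero' := by ext j; simp [hf]
      map_add' := fun x y ↦ by ext j; simp [hf, Finset.sum_add_distrib] }
  have hcont : Continuous f := by
    refine continuous_pi fun j ↦ ?_
    simp_rw [hf]
    fun_prop
  have hsurj : Function.Surjective f := by
    refine fun y ↦ ⟨fun i ↦ ∑ j, A⁻¹ i j • y j, ?_⟩
    ext j
    simp_rw [hf, Finset.smul_sum, smul_smul]
    rw [Finset.sum_comm]
    simp_rw [← Finset.sum_smul, ← Matrix.mul_apply, Matrix.mul_nonsing_inv A hA, Matrix.one_apply]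
    simp
  exact AddMonoidHom.measurePreserving (f := F) hcont hsurj rfl

/-- An ergodic toral endomorphism has no nontrivial character with a finite orbit. -/
theorem vecMul_pow_ne_of_ergodic (hf : ∀ x j, f x j = ∑ i, A j i • x i) (he : Ergodic f)
    {m : ℕ} (hm : 1 ≤ m) {k : d → ℤ} (hk : k ≠ 0) : k ᵥ* A ^ m ≠ k := by
  intro hkm
  let g : C(UnitAddTorus d, ℂ) := ∑ i ∈ Finset.range m, mFourier (k ᵥ* A ^ i)
  have hne (i : ℕ) (hi : i ∈ Finset.range m) : k ᵥ* A ^ i ≠ 0 := by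
    intro h0
    refine hk ?_
    rw [← hkm, ← Nat.add_sub_of_le (Finset.mem_range.mp hi).le, pow_add, ← Matrix.vecMul_vecMul, h0,
      Matrix.zero_vecMul]
  have hgf : g ∘ f = g := by
    ext x
    simp only [g, Function.comp_apply, ContinuousMap.sum_apply, mFourier_comp_apply hf,
      Matrix.vecMul_vecMul, ← pow_succ]
    have h := Finset.sum_range_succ' (fun i ↦ mFourier (k ᵥ* A ^ i) x) m
    rw [Finset.sum_range_succ] at h
    simpa [hkm] using h.symm
  obtain ⟨c, hc⟩ := he.ae_eq_const_of_ae_eq_comp_ae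
    (g.continuous.aestronglyMeasurable) (Filter.EventuallyEq.of_eq hgf)
  have hconst : (g : UnitAddTorus d → ℂ) = fun _ ↦ c :=
    Continuous.ae_eq_iff_eq volume g.continuous continuous_const |>.mp hc
  have hint : ∫ x, g x = 0 := by
    simp only [g, ContinuousMap.sum_apply]
    rw [integral_finsetSum _ fun i _ ↦
      (mFourier (k ᵥ* A ^ i)).continuous.integrable_of_hasCompactSupport
        (HasCompactSupport.of_compactSpace _)]
    exact Finset.sum_eq_zero fun i hi ↦ integral_mFourier (hne i hi)
  have hc0 : c = 0 := by simpa [hconst] using hint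
  have hm0 : g 0 = m := by simp [g, mFourier_eq_toCircle]
  rw [congr_fun hconst 0, hc0] at hm0
  exact (Nat.one_le_iff_ne_zero.mp hm) (by exact_mod_cast hm0.symm)

/-- A toral automorphism without nontrivial characters of finite orbit is ergodic. -/
theorem ergodic_of_vecMul_pow_ne (hA : IsUnit A.det) (hf : ∀ x j, f x j = ∑ i, A j i • x i)
    (h : ∀ m : ℕ, 1 ≤ m → ∀ k : d → ℤ, k ≠ 0 → k ᵥ* A ^ m ≠ k) : Ergodic f := by
  have hmp := measurePreserving hA hf
  refine ⟨hmp, ⟨fun s hs hfs ↦ ?_⟩⟩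
  let g : Lp ℂ 2 (volume : Measure (UnitAddTorus d)) :=
    indicatorConstLp 2 hs (measure_ne_top _ _) 1
  have hg : (g : UnitAddTorus d → ℂ) =ᵐ[volume] s.indicator fun _ ↦ 1 := indicatorConstLp_coeFn
  have hcoeff (k : d → ℤ) : mFourierCoeff g (k ᵥ* A) = mFourierCoeff g k := by
    have hind (l : d → ℤ) : mFourierCoeff g l = ∫ x in s, mFourier (-l) x := by
      rw [← integral_indicator hs]
      refine integral_congr_ae ?_
      filter_upwards [hg] with x hx
      rw [hx]
      by_cases hxs : x ∈ s <;> simp [hxs]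
    rw [hind, hind]
    have hmap := setIntegral_map (μ := volume) (g := f) (f := mFourier (-k)) hs
      (mFourier (-k)).continuous.aestronglyMeasurable hmp.measurable.aemeasurable
    rw [hmp.map_eq, hfs] at hmap
    simp only [hmap, mFourier_comp_apply hf, Matrix.neg_vecMul]
  have hzero (k : d → ℤ) (hk : k ≠ 0) : mFourierCoeff g k = 0 := by
    have horbit (i : ℕ) : mFourierCoeff g (k ᵥ* A ^ i) = mFourierCoeff g k := by
      induction i with
      | zero => simp
      | succ i ih => rw [pow_succ, ← Matrix.vecMul_vecMul, hcoeff, ih]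
    have hpow (i : ℕ) : Function.Injective fun v : d → ℤ ↦ v ᵥ* A ^ i :=
      Matrix.vecMul_injective_of_isUnit (((Matrix.isUnit_iff_isUnit_det A).mpr hA).pow i)
    have hinj : Function.Injective fun i : ℕ ↦ k ᵥ* A ^ i := by
      refine Function.Injective.of_lt_imp_ne fun i j hij heq ↦ h (j - i) (by omega) k hk (hpow i ?_)
      dsimp only at heq ⊢
      rw [Matrix.vecMul_vecMul, ← pow_add, Nat.sub_add_cancel hij.le, heq]
    have hsum := (hasSum_sq_mFourierCoeff g).summable.comp_injective hinj
    simp only [Function.comp_def, horbit] at hsum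
    simpa using tendsto_nhds_unique tendsto_const_nhds hsum.tendsto_atTop_zero
  have hsingle : g = mFourierCoeff g 0 • mFourierLp 2 0 :=
    (hasSum_mFourier_series_L2 g).unique <|
      hasSum_single 0 fun k hk ↦ by rw [hzero k hk, zero_smul]
  have hgconst : (g : UnitAddTorus d → ℂ) =ᵐ[volume] fun _ ↦ mFourierCoeff g 0 := by
    have h1 := Lp.coeFn_smul (mFourierCoeff g 0) (mFourierLp (d := d) 2 0)
    rw [← hsingle] at h1
    filter_upwards [h1, coeFn_mFourierLp 2 (0 : d → ℤ)] with x hx hx'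
    rw [hx, Pi.smul_apply, hx', mFourier_zero]
    simp
  have hs' := hg.symm.trans hgconst
  rw [Filter.eventuallyConst_set]
  by_cases hc : mFourierCoeff g 0 = 1
  · left
    filter_upwards [hs'] with x hx
    by_contra hxs
    simp [hxs, hc] at hx
  · right
    filter_upwards [hs'] with x hx hxs
    rw [Set.indicator_of_mem hxs] at hx
    exact hc hx.symm

theorem ergodic_iff_vecMul_pow_ne (hA : IsUnit A.det) (hf : ∀ x j, f x j = ∑ i, A j i • x i) :
    Ergodic f (Measure.pi fun _ ↦ AddCircle.haarAddCircle) ↔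
      ∀ m : ℕ, 1 ≤ m → ∀ k : d → ℤ, k ≠ 0 → k ᵥ* A ^ m ≠ k :=
  ⟨fun he _ hm _ hk ↦ vecMul_pow_ne_of_ergodic hf he hm hk, ergodic_of_vecMul_pow_ne hA hf⟩

end Fourier

end ToralAutomorphism

/-- A toral automorphism `f_A : 𝕋ⁿ → 𝕋ⁿ` induced by `A ∈ GL(n, ℤ)` is ergodic with
respect to Haar measure if and only if no (complex) eigenvalue of `A` is a root of
unity. -/
theorem toral_automorphism_ergodic_iff (n : ℕ) (A : Matrix (Fin n) (Fin n) ℤ)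
    (hA : IsUnit A.det)
    (f : (Fin n → AddCircle (1 : ℝ)) → (Fin n → AddCircle (1 : ℝ)))
    (hf : ∀ x j, f x j = ∑ i, A j i • x i) :
    Ergodic f volume ↔
      ∀ lam : ℂ, (A.map (Int.cast : ℤ → ℂ)).charpoly.IsRoot lam →
        ∀ m : ℕ, 1 ≤ m → lam ^ m ≠ 1 := by
  have hvol : (volume : Measure (Fin n → AddCircle (1 : ℝ))) =
      Measure.pi fun _ ↦ AddCircle.haarAddCircle := by
    simp [volume_pi, AddCircle.volume_eq_smul_haarAddCircle]
  rw [hvol, ToralAutomorphism.ergodic_iff_vecMul_pow_ne hA hf]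
  constructor
  · intro h lam hlam m hm hpow
    obtain ⟨k, hk, hkm⟩ :=
      (ToralAutomorphism.exists_isRoot_charpoly_pow_eq_one_iff A hm).mp ⟨lam, hlam, hpow⟩
    exact h m hm k hk hkm
  · intro h m hm k hk hkm
    obtain ⟨lam, hlam, hpow⟩ :=
      (ToralAutomorphism.exists_isRoot_charpoly_pow_eq_one_iff A hm).mpr ⟨k, hk, hkm⟩
    exact h lam hlam m hm hpow
end
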